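/- Let ψ : ℝ^D → ℝ be a differentiable convex function and let μ be a probability measure on ℝ^D with finite second moment such that ∇ψ♯μ also has finite second moment. Assume ψ is μ-integrable, x ↦ ⟨x, ∇ψ(x)⟩ is μ-integrable, and the convex conjugate ψ* is (∇ψ♯μ)-integrable. Then the squared Wasserstein-2 distance between μ and ∇ψ♯μ equals ∫_{ℝ^D} ‖x − ∇ψ(x)‖² dμ(x); that is, the infimum of ∫ ‖x − y‖² dπ(x, y) over all couplings π ∈ Π(μ, ∇ψ♯μ) is attained by the coupling (id, ∇ψ)♯μ and equals ∫ ‖x − ∇ψ(x)‖² dμ(x). -/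

import Mathlib

open MeasureTheory Real RealInnerProductSpace

/-- The convex conjugate `ψ*(y) = sup_x (⟨x, y⟩ - ψ(x))` (real-valued supremum). -/
noncomputable def convexConjReal {D : ℕ} (ψ : EuclideanSpace ℝ (Fin D) → ℝ)
    (y : EuclideanSpace ℝ (Fin D)) : ℝ :=
  ⨆ x : EuclideanSpace ℝ (Fin D), (⟪x, y⟫ - ψ x)

theorem ConvexOn.add_inner_gradient_le {F : Type*} [NormedAddCommGroup F] [InnerProductSpace ℝ F]
    [CompleteSpace F] {f : F → ℝ} (hf : ConvexOn ℝ Set.univ f) {x : F}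
    (hx : DifferentiableAt ℝ f x) (z : F) : f x + ⟪z - x, gradient f x⟫ ≤ f z := by
  have hline : ConvexOn ℝ Set.univ (fun t : ℝ => f (AffineMap.lineMap x z t)) :=
    hf.comp_affineMap (AffineMap.lineMap x z)
  have hderiv : HasDerivAt (fun t : ℝ => f (AffineMap.lineMap x z t)) (fderiv ℝ f x (z - x)) 0 := by
    have hx' : HasFDerivAt f (fderiv ℝ f x) (AffineMap.lineMap x z (0 : ℝ)) := by
      simpa using hx.hasFDerivAt
    exact hx'.comp_hasDerivAt 0 AffineMap.hasDerivAt_lineMap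
  have h := hline.le_slope_of_hasDerivAt (Set.mem_univ 0) (Set.mem_univ 1) one_pos hderiv
  have hfd : fderiv ℝ f x (z - x) = ⟪z - x, gradient f x⟫ := by
    rw [← toDual_gradient, InnerProductSpace.toDual_apply_apply, real_inner_comm]
  simp only [slope_def_field, AffineMap.lineMap_apply_zero, AffineMap.lineMap_apply_one, hfd] at h
  linarith

theorem measurable_gradient {F : Type*} [NormedAddCommGroup F] [InnerProductSpace ℝ F]
    [CompleteSpace F] [MeasurableSpace F] [BorelSpace F] (f : F → ℝ) :
    Measurable (gradient f) :=
  (InnerProductSpace.toDual ℝ F).symm.continuous.measurable.comp (measurable_fderiv ℝ f)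

theorem measurableSet_bddAbove_range_of_continuous {ι α : Type*} [TopologicalSpace α]
    [MeasurableSpace α] [OpensMeasurableSpace α] {f : ι → α → ℝ} (hf : ∀ i, Continuous (f i)) :
    MeasurableSet {a | BddAbove (Set.range fun i => f i a)} := by
  have h : {a | BddAbove (Set.range fun i => f i a)} = ⋃ n : ℕ, ⋂ i, {a | f i a ≤ n} := by
    ext a
    simp only [Set.mem_ofPred_eq, Set.mem_iUnion, Set.mem_iInter]
    constructor
    · rintro ⟨C, hC⟩
      obtain ⟨n, hn⟩ := exists_nat_ge C
      exact ⟨n, fun i => (hC ⟨i, rfl⟩).trans hn⟩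
    · rintro ⟨n, hn⟩
      exact ⟨n, by rintro _ ⟨i, rfl⟩; exact hn i⟩
  rw [h]
  exact .iUnion fun n =>
    (isClosed_iInter fun i => isClosed_le (hf i) continuous_const).measurableSet

theorem isLUB_range_inner_sub_gradient {D : ℕ} {ψ : EuclideanSpace ℝ (Fin D) → ℝ}
    (hconv : ConvexOn ℝ Set.univ ψ) {x : EuclideanSpace ℝ (Fin D)}
    (hx : DifferentiableAt ℝ ψ x) :
    IsLUB (Set.range fun z => ⟪z, gradient ψ x⟫ - ψ z) (⟪x, gradient ψ x⟫ - ψ x) := by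
  refine ⟨?_, fun b hb => hb ⟨x, rfl⟩⟩
  rintro _ ⟨z, rfl⟩
  have h := hconv.add_inner_gradient_le hx z
  rw [inner_sub_left] at h
  dsimp only
  linarith

theorem convexConjReal_gradient {D : ℕ} {ψ : EuclideanSpace ℝ (Fin D) → ℝ}
    (hconv : ConvexOn ℝ Set.univ ψ) {x : EuclideanSpace ℝ (Fin D)}
    (hx : DifferentiableAt ℝ ψ x) :
    convexConjReal ψ (gradient ψ x) = ⟪x, gradient ψ x⟫ - ψ x :=
  (isLUB_range_inner_sub_gradient hconv hx).ciSup_eq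

theorem integral_add_sub_two_mul_sub_two_mul {α : Type*} [MeasurableSpace α] {μ : Measure α}
    {f g h k : α → ℝ} (hf : Integrable f μ) (hg : Integrable g μ) (hh : Integrable h μ)
    (hk : Integrable k μ) :
    ∫ x, (f x + g x - 2 * h x - 2 * k x) ∂μ
      = ∫ x, f x ∂μ + ∫ x, g x ∂μ - 2 * ∫ x, h x ∂μ - 2 * ∫ x, k x ∂μ := by
  rw [integral_sub (by fun_prop) (by fun_prop), integral_sub (by fun_prop) (by fun_prop),
    integral_add hf hg, integral_const_mul, integral_const_mul]

/-- The dual cost `‖x‖² + ‖y‖² - 2 ψ(x) - 2 ψ*(y)` is bounded by the quadratic cost almost surely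
under any measure whose second marginal is `∇ψ♯μ`. -/
theorem ae_dual_cost_le_norm_sub_sq {D : ℕ} {ψ : EuclideanSpace ℝ (Fin D) → ℝ}
    (hdiff : Differentiable ℝ ψ) (hconv : ConvexOn ℝ Set.univ ψ)
    {μ : Measure (EuclideanSpace ℝ (Fin D))}
    {γ : Measure (EuclideanSpace ℝ (Fin D) × EuclideanSpace ℝ (Fin D))}
    (hγ : γ.map Prod.snd = μ.map (gradient ψ)) :
    ∀ᵐ q ∂γ, ‖q.1‖ ^ 2 + ‖q.2‖ ^ 2 - 2 * ψ q.1 - 2 * convexConjReal ψ q.2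
      ≤ ‖q.1 - q.2‖ ^ 2 := by
  have hbdd : ∀ᵐ y ∂(γ.map Prod.snd), BddAbove (Set.range fun x => ⟪x, y⟫ - ψ x) := by
    rw [hγ, ae_map_iff (measurable_gradient ψ).aemeasurable
      (measurableSet_bddAbove_range_of_continuous fun x => by fun_prop)]
    exact .of_forall fun x => (isLUB_range_inner_sub_gradient hconv (hdiff x)).bddAbove
  filter_upwards [ae_of_ae_map measurable_snd.aemeasurable hbdd] with q hq
  have h : ⟪q.1, q.2⟫ - ψ q.1 ≤ convexConjReal ψ q.2 := le_ciSup hq q.1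
  rw [norm_sub_sq_real]
  linarith

/-- For a differentiable convex `ψ`, the squared Wasserstein-2 distance between `μ` and
`∇ψ♯μ` equals `∫ ‖x - ∇ψ(x)‖² dμ(x)`: the infimum of the transport cost over couplings of
`μ` and `∇ψ♯μ` is attained by the graph coupling `(id, ∇ψ)♯μ` and equals this integral. -/
theorem w2sq_to_gradient_pushforward
    {D : ℕ} (ψ : EuclideanSpace ℝ (Fin D) → ℝ)
    (hdiff : Differentiable ℝ ψ) (hconv : ConvexOn ℝ Set.univ ψ)
    (μ : Measure (EuclideanSpace ℝ (Fin D))) [IsProbabilityMeasure μ]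
    (hmom : Integrable (fun x => ‖x‖ ^ 2) μ)
    (hmom' : Integrable (fun y => ‖y‖ ^ 2) (μ.map (gradient ψ)))
    (hψint : Integrable ψ μ)
    (hinner : Integrable (fun x => ⟪x, gradient ψ x⟫) μ)
    (hconj : Integrable (convexConjReal ψ) (μ.map (gradient ψ))) :
    (μ.map (fun x => (x, gradient ψ x))).map Prod.fst = μ ∧
    (μ.map (fun x => (x, gradient ψ x))).map Prod.snd = μ.map (gradient ψ) ∧
    (∫⁻ q, ENNReal.ofReal (‖q.1 - q.2‖ ^ 2) ∂(μ.map (fun x => (x, gradient ψ x))))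
      = ENNReal.ofReal (∫ x, ‖x - gradient ψ x‖ ^ 2 ∂μ) ∧
    IsLeast
      { L : ENNReal | ∃ γ : Measure (EuclideanSpace ℝ (Fin D) × EuclideanSpace ℝ (Fin D)),
          IsProbabilityMeasure γ ∧ γ.map Prod.fst = μ ∧
          γ.map Prod.snd = μ.map (gradient ψ) ∧
          L = ∫⁻ q, ENNReal.ofReal (‖q.1 - q.2‖ ^ 2) ∂γ }
      (ENNReal.ofReal (∫ x, ‖x - gradient ψ x‖ ^ 2 ∂μ)) := by
  have hgrad : Measurable (gradient ψ) := measurable_gradient ψ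
  have hpair : Measurable (fun x => (x, gradient ψ x)) := measurable_id.prodMk hgrad
  have hcost : Measurable fun q : EuclideanSpace ℝ (Fin D) × EuclideanSpace ℝ (Fin D) =>
      ‖q.1 - q.2‖ ^ 2 := by fun_prop
  have hmom_grad : Integrable (fun x => ‖gradient ψ x‖ ^ 2) μ := hmom'.comp_measurable hgrad
  have hint : Integrable (fun x => ‖x - gradient ψ x‖ ^ 2) μ := by
    simp_rw [norm_sub_sq_real]
    exact (hmom.sub (hinner.const_mul 2)).add hmom_grad
  have hfst : (μ.map (fun x => (x, gradient ψ x))).map Prod.fst = μ := by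
    rw [Measure.map_map measurable_fst hpair]
    exact Measure.map_id
  have hsnd : (μ.map (fun x => (x, gradient ψ x))).map Prod.snd = μ.map (gradient ψ) :=
    Measure.map_map measurable_snd hpair
  have hgraph : (∫⁻ q, ENNReal.ofReal (‖q.1 - q.2‖ ^ 2) ∂(μ.map (fun x => (x, gradient ψ x))))
      = ENNReal.ofReal (∫ x, ‖x - gradient ψ x‖ ^ 2 ∂μ) := by
    rw [lintegral_map hcost.ennreal_ofReal hpair,
      ofReal_integral_eq_lintegral_ofReal hint (.of_forall fun x => by positivity)]
  refine ⟨hfst, hsnd, hgraph,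
    ⟨_, Measure.isProbabilityMeasure_map hpair.aemeasurable, hfst, hsnd, hgraph.symm⟩, ?_⟩
  rintro _ ⟨γ, -, hγ₁, hγ₂, rfl⟩
  have comp_fst {f : EuclideanSpace ℝ (Fin D) → ℝ} (hf : Integrable f μ) :
      Integrable (fun q => f q.1) γ ∧ ∫ q, f q.1 ∂γ = ∫ x, f x ∂μ := by
    rw [← hγ₁] at hf ⊢
    exact ⟨hf.comp_measurable measurable_fst,
      (integral_map measurable_fst.aemeasurable hf.aestronglyMeasurable).symm⟩
  have comp_snd {f : EuclideanSpace ℝ (Fin D) → ℝ} (hf : Integrable f (μ.map (gradient ψ))) :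
      Integrable (fun q => f q.2) γ ∧ ∫ q, f q.2 ∂γ = ∫ x, f (gradient ψ x) ∂μ := by
    rw [← integral_map hgrad.aemeasurable hf.aestronglyMeasurable]
    rw [← hγ₂] at hf ⊢
    exact ⟨hf.comp_measurable measurable_snd,
      (integral_map measurable_snd.aemeasurable hf.aestronglyMeasurable).symm⟩
  obtain ⟨hx_int, hx_eq⟩ := comp_fst hmom
  obtain ⟨hy_int, hy_eq⟩ := comp_snd hmom'
  obtain ⟨hψ_int, hψ_eq⟩ := comp_fst hψint
  obtain ⟨hc_int, hc_eq⟩ := comp_snd hconj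
  have hcost_int : Integrable (fun q => ‖q.1 - q.2‖ ^ 2) γ := by
    refine ((hx_int.add hy_int).const_mul 2).mono' hcost.aestronglyMeasurable
      (.of_forall fun q => ?_)
    rw [Real.norm_of_nonneg (by positivity)]
    have h := parallelogram_law_with_norm ℝ q.1 q.2
    simp only [Pi.add_apply]
    nlinarith [mul_self_nonneg ‖q.1 + q.2‖]
  rw [← ofReal_integral_eq_lintegral_ofReal hcost_int (.of_forall fun q => by positivity)]
  refine ENNReal.ofReal_le_ofReal ?_
  calc ∫ x, ‖x - gradient ψ x‖ ^ 2 ∂μ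
      = ∫ x, (‖x‖ ^ 2 + ‖gradient ψ x‖ ^ 2 - 2 * ψ x
          - 2 * convexConjReal ψ (gradient ψ x)) ∂μ := by
        congr 1 with x
        rw [convexConjReal_gradient hconv (hdiff x), norm_sub_sq_real]
        ring
    _ = ∫ q, (‖q.1‖ ^ 2 + ‖q.2‖ ^ 2 - 2 * ψ q.1 - 2 * convexConjReal ψ q.2) ∂γ := by
        have hconj_grad : Integrable (fun x => convexConjReal ψ (gradient ψ x)) μ :=
          hconj.comp_measurable hgrad
        rw [integral_add_sub_two_mul_sub_two_mul hmom hmom_grad hψint hconj_grad,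
          integral_add_sub_two_mul_sub_two_mul hx_int hy_int hψ_int hc_int,
          hx_eq, hy_eq, hψ_eq, hc_eq]
    _ ≤ ∫ q, ‖q.1 - q.2‖ ^ 2 ∂γ :=
        integral_mono_ae (((hx_int.add hy_int).sub (hψ_int.const_mul 2)).sub
          (hc_int.const_mul 2)) hcost_int (ae_dual_cost_le_norm_sub_sq hdiff hconv hγ₂)
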